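/- There exist a Hilbert space X, a generator A of an exponentially stable analytic semigroup on X, and an observation operator C ∈ L(X_1, ℂ) that is L^1-observation-admissible, such that the system node Σ(A, 𝕀, C, C(·−A)^{-1}) (with identity input operator) is not L^∞-BIBO stable. -/

import Mathlib

/-- A bundled complex Banach space (declared before `open MeasureTheory`, whose
notations interfere with instance-binder fields in structures). -/
structure CplxBanach where
  carrier : Type
  [nacg : NormedAddCommGroup carrier]
  [nsp : NormedSpace ℂ carrier]
  [cs : CompleteSpace carrier]

attribute [instance] CplxBanach.nacg CplxBanach.nsp CplxBanach.cs

/-- A bundled complex Hilbert space. -/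
structure CplxHilbert where
  carrier : Type
  [nacg : NormedAddCommGroup carrier]
  [ips : InnerProductSpace ℂ carrier]
  [cs : CompleteSpace carrier]

attribute [instance] CplxHilbert.nacg CplxHilbert.ips CplxHilbert.cs

open MeasureTheory Set
open scoped ENNReal NNReal Topology

noncomputable section

/-- A strongly continuous semigroup of bounded linear operators on a complex Banach space. -/
structure C0Semigroup (X : Type*) [NormedAddCommGroup X] [NormedSpace ℂ X] where
  T : ℝ → X →L[ℂ] X
  map_zero : T 0 = ContinuousLinearMap.id ℂ X
  map_add : ∀ s t : ℝ, 0 ≤ s → 0 ≤ t → T (s + t) = (T s).comp (T t)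
  strongly_continuous : ∀ x : X, ContinuousOn (fun t => T t x) (Set.Ici 0)

namespace C0Semigroup

variable {X : Type*} [NormedAddCommGroup X] [NormedSpace ℂ X]

/-- The growth bound `ω(T)` of a strongly continuous semigroup. -/
def growthBound (S : C0Semigroup X) : ℝ :=
  sInf {w : ℝ | ∃ M : ℝ, ∀ t : ℝ, 0 ≤ t → ‖S.T t‖ ≤ M * Real.exp (w * t)}

/-- Exponential stability of a strongly continuous semigroup. -/
def ExpStable (S : C0Semigroup X) : Prop :=
  ∃ ε : ℝ, 0 < ε ∧ ∃ M : ℝ, ∀ t : ℝ, 0 ≤ t → ‖S.T t‖ ≤ M * Real.exp (-ε * t)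

/-- The semigroup is analytic: it extends analytically to an open sector around the
positive real axis, the extension satisfying the semigroup property on the sector. -/
def IsAnalytic (S : C0Semigroup X) : Prop :=
  ∃ θ : ℝ, θ ∈ Set.Ioo 0 (Real.pi / 2) ∧ ∃ F : ℂ → X →L[ℂ] X,
    DifferentiableOn ℂ F {z : ℂ | z ≠ 0 ∧ |Complex.arg z| < θ} ∧
    (∀ t : ℝ, 0 < t → F t = S.T t) ∧
    (∀ z w : ℂ, (z ≠ 0 ∧ |Complex.arg z| < θ) → (w ≠ 0 ∧ |Complex.arg w| < θ) →
      F (z + w) = (F z).comp (F w))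

/-- The fractional power `(-A)^{-γ}` of the negative generator of an exponentially
stable semigroup, defined through the standard integral formula
`(-A)^{-γ} = Γ(γ)⁻¹ ∫_0^∞ t^{γ-1} T(t) dt` (and the identity for `γ = 0`). -/
def negAPow (S : C0Semigroup X) (γ : ℝ) : X →L[ℂ] X :=
  if γ = 0 then ContinuousLinearMap.id ℂ X
  else (Real.Gamma γ)⁻¹ • ∫ t in Set.Ioi (0:ℝ), t ^ (γ - 1) • S.T t

end C0Semigroup

/-- A system node `Σ(A,B,C,G)` on the Banach spaces `(U, X, Y)`, in the sense of Staffans.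
The extrapolation space `X_{-1}` is given as the space `Xm1` together with a dense
continuous embedding `ι : X → X_{-1}`; `Am1 : X → X_{-1}` is the extension
`A_{-1}` of the generator restricted to `X` (which is bounded from `X` to `X_{-1}`);
the domain of `A` is the set of `x ∈ X` with `A_{-1} x ∈ X`.  `R s` is the resolvent
`(s - A_{-1})^{-1} : X_{-1} → X`, defined (as specified by `R_right`, `R_left`) for
`Re s > ω(T)`.  `B : U → X_{-1}` is the control operator and `Cop` is the observation
operator `C : X_1 → Y`, encoded as a map on all of `X` that is linear and
`X_1`-bounded on the domain of `A`.  `G` is the transfer function. -/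
structure SystemNode (U : Type*) (X : Type*) (Xm1 : Type*) (Y : Type*)
    [NormedAddCommGroup U] [NormedSpace ℂ U]
    [NormedAddCommGroup X] [NormedSpace ℂ X]
    [NormedAddCommGroup Xm1] [NormedSpace ℂ Xm1]
    [NormedAddCommGroup Y] [NormedSpace ℂ Y] where
  S : C0Semigroup X
  Sm1 : C0Semigroup Xm1
  ι : X →L[ℂ] Xm1
  ι_injective : Function.Injective (fun x : X => ι x)
  ι_dense : DenseRange (fun x : X => ι x)
  semigroup_compat : ∀ t : ℝ, 0 ≤ t → ∀ x : X, Sm1.T t (ι x) = ι (S.T t x)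
  Am1 : X →L[ℂ] Xm1
  generator : ∀ x : X, ∀ t : ℝ, 0 ≤ t →
    HasDerivWithinAt (fun τ : ℝ => ι (S.T τ x)) (Am1 (S.T t x)) (Set.Ici 0) t
  B : U →L[ℂ] Xm1
  Cop : X → Y
  Cop_add : ∀ x₁ x₂ : X, (∃ z : X, Am1 x₁ = ι z) → (∃ z : X, Am1 x₂ = ι z) →
    Cop (x₁ + x₂) = Cop x₁ + Cop x₂
  Cop_smul : ∀ (a : ℂ) (x : X), (∃ z : X, Am1 x = ι z) → Cop (a • x) = a • Cop x
  Cop_bound : ∃ M : ℝ, ∀ x z : X, Am1 x = ι z → ‖Cop x‖ ≤ M * (‖x‖ + ‖z‖)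
  R : ℂ → Xm1 →L[ℂ] X
  R_right : ∀ s : ℂ, S.growthBound < s.re → ∀ w : Xm1, s • ι (R s w) - Am1 (R s w) = w
  R_left : ∀ s : ℂ, S.growthBound < s.re → ∀ x : X, R s (s • ι x - Am1 x) = x
  G : ℂ → U →L[ℂ] Y
  G_analytic : DifferentiableOn ℂ (fun s => G s) {s : ℂ | S.growthBound < s.re}
  G_shift : ∀ α β : ℂ, S.growthBound < α.re → S.growthBound < β.re → ∀ u : U,
    G α u - G β u = Cop (R α (B u) - R β (B u))

namespace SystemNode

variable {U X Xm1 Y : Type*}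
  [NormedAddCommGroup U] [NormedSpace ℂ U]
  [NormedAddCommGroup X] [NormedSpace ℂ X]
  [NormedAddCommGroup Xm1] [NormedSpace ℂ Xm1]
  [NormedAddCommGroup Y] [NormedSpace ℂ Y]

/-- The domain of the generator `A`: those `x ∈ X` with `A_{-1} x ∈ X`. -/
def domA (sys : SystemNode U X Xm1 Y) : Set X := {x : X | ∃ z : X, sys.Am1 x = sys.ι z}

/-- A fixed point in the half-plane of analyticity of the transfer function. -/
def betaPt (sys : SystemNode U X Xm1 Y) : ℂ := ((sys.S.growthBound + 1 : ℝ) : ℂ)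

/-- The combined observation/feedthrough operator
`C&D (x,u) = C[x - (β - A)⁻¹ B u] + G(β) u`. -/
def CD (sys : SystemNode U X Xm1 Y) (x : X) (u : U) : Y :=
  sys.Cop (x - sys.R sys.betaPt (sys.B u)) + sys.G sys.betaPt u

/-- The pair `(x,u)` belongs to the domain of the combined operator `C&D`,
i.e. `A_{-1} x + B u ∈ X`. -/
def memCD (sys : SystemNode U X Xm1 Y) (x : X) (u : U) : Prop :=
  ∃ z : X, sys.Am1 x + sys.B u = sys.ι z

/-- A classical solution `(u,x,y)` of the system node on `[0,∞)`:
`u, y` continuous, `x` continuously differentiable with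
`ẋ(t) = A x(t) + B u(t)` (in particular `(x(t),u(t)) ∈ D(C&D)`) and
`y(t) = C&D (x(t),u(t))` for all `t ≥ 0`. -/
def IsClassicalSolution (sys : SystemNode U X Xm1 Y)
    (u : ℝ → U) (x : ℝ → X) (y : ℝ → Y) : Prop :=
  ContinuousOn u (Set.Ici 0) ∧ ContinuousOn y (Set.Ici 0) ∧
  (∃ x' : ℝ → X, ContinuousOn x' (Set.Ici 0) ∧
    (∀ t ∈ Set.Ici (0:ℝ), HasDerivWithinAt x (x' t) (Set.Ici 0) t) ∧
    (∀ t ∈ Set.Ici (0:ℝ), sys.Am1 (x t) + sys.B (u t) = sys.ι (x' t))) ∧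
  (∀ t ∈ Set.Ici (0:ℝ), y t = sys.CD (x t) (u t))

/-- `C^∞`-BIBO stability: there is `c > 0` such that every classical solution with
zero initial state and smooth input compactly supported in `(0,∞)` has output
bounded by `c` times the sup-norm of the input. -/
def CInfBIBOStable (sys : SystemNode U X Xm1 Y) : Prop :=
  ∃ c : ℝ, 0 < c ∧ ∀ (u : ℝ → U) (x : ℝ → X) (y : ℝ → Y),
    sys.IsClassicalSolution u x y → x 0 = 0 →
    ContDiff ℝ (⊤ : ℕ∞) u → HasCompactSupport u → tsupport u ⊆ Set.Ioi 0 →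
    ∀ M : ℝ, (∀ s : ℝ, ‖u s‖ ≤ M) → ∀ t : ℝ, 0 ≤ t → ‖y t‖ ≤ c * M

/-- The state part of a generalised solution in the distributional sense:
`u ∈ L¹_loc`, `x` continuous `X_{-1}`-valued, given by the variation of
constants formula with initial state `x₀ ∈ X`. -/
def IsMildState (sys : SystemNode U X Xm1 Y) (x₀ : X) (u : ℝ → U) (xs : ℝ → Xm1) : Prop :=
  MeasureTheory.LocallyIntegrableOn u (Set.Ici 0) ∧
  ContinuousOn xs (Set.Ici 0) ∧
  ∀ t : ℝ, 0 ≤ t →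
    IntervalIntegrable (fun s => sys.Sm1.T (t - s) (sys.B (u s))) MeasureTheory.volume 0 t ∧
    xs t = sys.Sm1.T t (sys.ι x₀) + ∫ s in (0:ℝ)..t, sys.Sm1.T (t - s) (sys.B (u s))

/-- The output part of a generalised solution in the distributional sense: the
(locally integrable representative of the) `Y`-valued distribution
`y = d²/dt² ( C&D ∫_0^t (t-s) (x(s), u(s)) ds )`. -/
def IsGenOutput (sys : SystemNode U X Xm1 Y) (u : ℝ → U) (xs : ℝ → Xm1) (y : ℝ → Y) : Prop :=
  MeasureTheory.LocallyIntegrableOn y (Set.Ici 0) ∧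
  ∃ (K : ℝ → X) (L : ℝ → U),
    (∀ t : ℝ, 0 ≤ t → sys.ι (K t) = ∫ s in (0:ℝ)..t, (t - s) • xs s) ∧
    (∀ t : ℝ, 0 ≤ t → L t = ∫ s in (0:ℝ)..t, (t - s) • u s) ∧
    (∀ t : ℝ, 0 ≤ t → sys.memCD (K t) (L t)) ∧
    (∀ φ : ℝ → ℝ, ContDiff ℝ (⊤ : ℕ∞) φ → HasCompactSupport φ → tsupport φ ⊆ Set.Ioi 0 →
      ∫ t in Set.Ioi (0:ℝ), deriv (deriv φ) t • sys.CD (K t) (L t) =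
        ∫ t in Set.Ioi (0:ℝ), φ t • y t)

/-- A generalised solution in the distributional sense. -/
def IsGeneralizedSolution (sys : SystemNode U X Xm1 Y) (x₀ : X)
    (u : ℝ → U) (xs : ℝ → Xm1) (y : ℝ → Y) : Prop :=
  sys.IsMildState x₀ u xs ∧ sys.IsGenOutput u xs y

/-- `L^∞`-BIBO stability: there is `c > 0` such that for every generalised solution in
the distributional sense with zero initial state and locally essentially bounded input,
the output is represented by a locally essentially bounded function with
`‖y‖_{L^∞([0,t])} ≤ c ‖u‖_{L^∞([0,t])}` for all `t > 0`. -/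
def LInfBIBOStable (sys : SystemNode U X Xm1 Y) : Prop :=
  ∃ c : ℝ, 0 < c ∧ ∀ (u : ℝ → U) (xs : ℝ → Xm1),
    sys.IsMildState 0 u xs →
    (∀ t : ℝ, 0 < t → ∃ M : ℝ,
      ∀ᵐ s ∂(MeasureTheory.volume.restrict (Set.Ioc (0:ℝ) t)), ‖u s‖ ≤ M) →
    ∃ y : ℝ → Y, sys.IsGenOutput u xs y ∧
      ∀ t : ℝ, 0 < t → ∀ M : ℝ,
        (∀ᵐ s ∂(MeasureTheory.volume.restrict (Set.Ioc (0:ℝ) t)), ‖u s‖ ≤ M) →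
        (∀ᵐ s ∂(MeasureTheory.volume.restrict (Set.Ioc (0:ℝ) t)), ‖y s‖ ≤ c * M)

/-- `L^p`-control-admissibility of the control operator `B`. -/
def ControlAdmissible (sys : SystemNode U X Xm1 Y) (p : ℝ≥0∞) : Prop :=
  ∀ t : ℝ, 0 < t → ∃ M : ℝ, ∀ u : ℝ → U,
    IntervalIntegrable (fun s => sys.Sm1.T (t - s) (sys.B (u s))) MeasureTheory.volume 0 t →
    ∃ x : X, sys.ι x = ∫ s in (0:ℝ)..t, sys.Sm1.T (t - s) (sys.B (u s)) ∧
      ‖x‖ ≤ M * (eLpNorm u p (MeasureTheory.volume.restrict (Set.Ioc (0:ℝ) t))).toReal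

/-- Infinite-time `L^p`-control-admissibility: the admissibility constant can be chosen
uniformly in `t`. -/
def InfTimeControlAdmissible (sys : SystemNode U X Xm1 Y) (p : ℝ≥0∞) : Prop :=
  ∃ M : ℝ, ∀ t : ℝ, 0 < t → ∀ u : ℝ → U,
    IntervalIntegrable (fun s => sys.Sm1.T (t - s) (sys.B (u s))) MeasureTheory.volume 0 t →
    ∃ x : X, sys.ι x = ∫ s in (0:ℝ)..t, sys.Sm1.T (t - s) (sys.B (u s)) ∧
      ‖x‖ ≤ M * (eLpNorm u p (MeasureTheory.volume.restrict (Set.Ioc (0:ℝ) t))).toReal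

/-- `L^p`-observation-admissibility of the observation operator `C`. -/
def ObservationAdmissible (sys : SystemNode U X Xm1 Y) (p : ℝ≥0∞) : Prop :=
  ∃ t : ℝ, 0 < t ∧ ∃ M : ℝ, ∀ x z : X, sys.Am1 x = sys.ι z →
    (eLpNorm (fun s : ℝ => sys.Cop (sys.S.T s x)) p
      (MeasureTheory.volume.restrict (Set.Ioc (0:ℝ) t))).toReal ≤ M * ‖x‖

/-- `L²`-well-posedness of a system node: `B` and `C` are `L²`-admissible and the
transfer function is bounded on some right half-plane. -/
def L2WellPosed (sys : SystemNode U X Xm1 Y) : Prop :=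
  sys.ControlAdmissible 2 ∧ sys.ObservationAdmissible 2 ∧
  ∃ w : ℝ, sys.S.growthBound ≤ w ∧ ∃ M : ℝ, ∀ s : ℂ, w < s.re → ‖sys.G s‖ ≤ M

end SystemNode

/-- A (matrix/operator valued) Borel measure of bounded total variation on `[0,∞)`,
encoded through its polar decomposition: a finite positive measure `μ` supported on
`[0,∞)` together with a density `g` of norm one. -/
structure BVMeasure (U Y : Type*) [NormedAddCommGroup U] [NormedSpace ℂ U]
    [NormedAddCommGroup Y] [NormedSpace ℂ Y] where
  μ : MeasureTheory.Measure ℝ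
  finite : MeasureTheory.IsFiniteMeasure μ
  supported : μ (Set.Iio 0) = 0
  g : ℝ → U →L[ℂ] Y
  g_meas : MeasureTheory.AEStronglyMeasurable g μ
  g_norm : ∀ᵐ t ∂μ, ‖g t‖ = 1

namespace BVMeasure

variable {U Y : Type*} [NormedAddCommGroup U] [NormedSpace ℂ U]
  [NormedAddCommGroup Y] [NormedSpace ℂ Y]

/-- The total variation `‖h‖_M` of the measure. -/
def var (h : BVMeasure U Y) : ℝ := (h.μ Set.univ).toReal

/-- The Laplace transform `ĥ(s) u = ∫ e^{-st} dh(t) u`. -/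
def laplace (h : BVMeasure U Y) (s : ℂ) (u : U) : Y :=
  ∫ t, Complex.exp (-(s * t)) • (h.g t u) ∂h.μ

/-- The convolution `(h ∗ u)(t) = ∫_{[0,t]} dh(s) u(t - s)`. -/
def conv (h : BVMeasure U Y) (u : ℝ → U) (t : ℝ) : Y :=
  ∫ s in Set.Icc 0 t, (h.g s) (u (t - s)) ∂h.μ

end BVMeasure

/-- The Laplace transform of `h` coincides with the transfer function of the node on
the half-plane `ℂ_{ω(T)}` (on `ℂ_{ω(T)} ∩ ℂ_0`, identifying `ĥ` with its analytic
continuation). -/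
def LaplaceMatches {U X Xm1 Y : Type*}
    [NormedAddCommGroup U] [NormedSpace ℂ U]
    [NormedAddCommGroup X] [NormedSpace ℂ X]
    [NormedAddCommGroup Xm1] [NormedSpace ℂ Xm1]
    [NormedAddCommGroup Y] [NormedSpace ℂ Y]
    (sys : SystemNode U X Xm1 Y) (h : BVMeasure U Y) : Prop :=
  ∀ s : ℂ, sys.S.growthBound < s.re → 0 ≤ s.re → ∀ u : U, h.laplace s u = sys.G s u

/-- `sys'` is a system node for the multiplicatively perturbed triple `(AP, B, C)`. -/
def IsMultPerturbed {U X Xm1 Y : Type*}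
    [NormedAddCommGroup U] [NormedSpace ℂ U]
    [NormedAddCommGroup X] [NormedSpace ℂ X]
    [NormedAddCommGroup Xm1] [NormedSpace ℂ Xm1]
    [NormedAddCommGroup Y] [NormedSpace ℂ Y]
    (sys sys' : SystemNode U X Xm1 Y) (P : X →L[ℂ] X) : Prop :=
  sys'.ι = sys.ι ∧ sys'.Am1 = sys.Am1.comp P ∧ sys'.B = sys.B ∧ sys'.Cop = sys.Cop

/-- `sys'` is a system node for the additively perturbed triple `(A + P, B, C)`. -/
def IsAddPerturbed {U X Xm1 Y : Type*}
    [NormedAddCommGroup U] [NormedSpace ℂ U]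
    [NormedAddCommGroup X] [NormedSpace ℂ X]
    [NormedAddCommGroup Xm1] [NormedSpace ℂ Xm1]
    [NormedAddCommGroup Y] [NormedSpace ℂ Y]
    (sys sys' : SystemNode U X Xm1 Y) (P : X →L[ℂ] X) : Prop :=
  sys'.ι = sys.ι ∧ sys'.Am1 = sys.Am1 + sys.ι.comp P ∧ sys'.B = sys.B ∧ sys'.Cop = sys.Cop

end

/-- Witness data for Proposition 6.5: a Hilbert space `X`, a generator of an
exponentially stable analytic semigroup on `X`, and an `L¹`-observation-admissible
observation operator `C ∈ L(X_1, ℂ)` such that the system node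
`Σ(A, 𝕀, C, C(·-A)⁻¹)` (identity input operator) is not `L^∞`-BIBO stable. -/
structure L1AdmissibleNotBIBOWitness where
  W : CplxHilbert
  Wm1 : CplxBanach
  node : SystemNode W.carrier W.carrier Wm1.carrier ℂ
  expStable : node.S.ExpStable
  analytic : node.S.IsAnalytic
  -- the input operator is the identity `𝕀 : X → X`:
  input_identity : ∀ x : W.carrier, node.B x = node.ι x
  -- the transfer function is `G(s) = C (s - A)⁻¹`:
  transfer_eq : ∀ s : ℂ, node.S.growthBound < s.re → ∀ x : W.carrier,
    node.G s x = node.Cop (node.R s (node.ι x))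
  -- `C` is `L¹`-observation-admissible:
  obsAdmissible : node.ObservationAdmissible 1
  -- the node is not `L^∞`-BIBO stable:
  not_bibo : ¬ node.LInfBIBOStable


section witness

/-- The state space. -/
abbrev XX : Type := lp (fun _ : ℕ => ℂ) 2

theorem XX_ext {x y : XX} (h : ∀ n, x n = y n) : x = y := lp.ext (funext h)

theorem XX_sq (x : XX) : HasSum (fun n => ‖x n‖ ^ 2) (‖x‖ ^ 2) := by
  have := lp.hasSum_norm (p := 2) (by norm_num) x
  simpa using this

theorem XX_mul_mem (b : ℕ → ℂ) (C : ℝ) (hb : ∀ n, ‖b n‖ ≤ C) (x : XX) :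
    Memℓp (fun n => b n * x n) 2 := by
  apply memℓp_gen
  have h := (XX_sq x).summable.mul_left (C ^ 2)
  refine Summable.of_nonneg_of_le (fun n => by positivity) (fun n => ?_) h
  simp only [norm_mul, ENNReal.toReal_ofNat, Real.rpow_ofNat]
  rw [mul_pow]
  gcongr
  exact hb n

theorem XX_norm_le (x y : XX) (C : ℝ) (hC : 0 ≤ C) (h : ∀ n, ‖x n‖ ≤ C * ‖y n‖) :
    ‖x‖ ≤ C * ‖y‖ := by
  have h1 := hasSum_le (fun n => (pow_le_pow_left₀ (norm_nonneg _) (h n) 2).trans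
    (le_of_eq (mul_pow _ _ 2))) (XX_sq x) ((XX_sq y).mul_left (C ^ 2))
  rw [← mul_pow] at h1
  exact (pow_le_pow_iff_left₀ (norm_nonneg _) (by positivity) two_ne_zero).1 h1

open Classical in
/-- The diagonal operator. -/
noncomputable def dg (b : ℕ → ℂ) : XX →L[ℂ] XX :=
  if h : ∃ C, ∀ n, ‖b n‖ ≤ C then
    LinearMap.mkContinuous
      { toFun := fun x => ⟨fun n => b n * x n, XX_mul_mem b h.choose h.choose_spec x⟩
        map_add' := fun x y => XX_ext fun n => mul_add _ _ _
        map_smul' := fun c x => XX_ext fun n => mul_left_comm _ _ _ }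
      h.choose
      (fun x => XX_norm_le _ _ _ ((norm_nonneg _).trans (h.choose_spec 0)) (fun n => by
        show ‖b n * x n‖ ≤ _
        rw [norm_mul]
        gcongr
        exact h.choose_spec n))
  else 0

theorem dg_apply (b : ℕ → ℂ) (C : ℝ) (h : ∀ n, ‖b n‖ ≤ C) (x : XX) (n : ℕ) :
    dg b x n = b n * x n := by
  have h' : ∃ C, ∀ n, ‖b n‖ ≤ C := ⟨C, h⟩
  rw [dg, dif_pos h']
  rfl

theorem dg_norm (b : ℕ → ℂ) (C : ℝ) (h : ∀ n, ‖b n‖ ≤ C) : ‖dg b‖ ≤ C := by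
  have hC := (norm_nonneg _).trans (h 0)
  refine ContinuousLinearMap.opNorm_le_bound _ hC fun x => XX_norm_le _ _ _ hC fun n => ?_
  rw [dg_apply b C h, norm_mul]
  gcongr
  exact h n

theorem dg_cont (b : ℝ → ℕ → ℂ) (hb : ∀ t n, ‖b t n‖ ≤ 1) (hc : ∀ n, Continuous fun t => b t n)
    (x : XX) : Continuous fun t => dg (b t) x := by
  rw [continuous_iff_continuousAt]
  intro t0
  rw [ContinuousAt, tendsto_iff_norm_sub_tendsto_zero]
  have hcont : Continuous fun t => ∑' n, ‖(b t n - b t0 n) * x n‖ ^ 2 := by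
    refine continuous_tsum (u := fun n => 4 * ‖x n‖ ^ 2) (fun n => ?_)
      ((XX_sq x).summable.mul_left 4) (fun n t => ?_)
    · have := hc n
      fun_prop
    · have h1 : ‖b t n - b t0 n‖ ≤ 2 := (norm_sub_le _ _).trans (by linarith [hb t n, hb t0 n])
      rw [norm_pow, norm_norm, norm_mul, mul_pow]
      gcongr
      nlinarith [norm_nonneg (b t n - b t0 n)]
  have heq : ∀ t, ‖dg (b t) x - dg (b t0) x‖ = √(∑' n, ‖(b t n - b t0 n) * x n‖ ^ 2) := by
    intro t
    rw [← Real.sqrt_sq (norm_nonneg (dg (b t) x - dg (b t0) x)),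
      ← (XX_sq (dg (b t) x - dg (b t0) x)).tsum_eq]
    congr 1
    refine tsum_congr fun n => ?_
    rw [lp.coeFn_sub, Pi.sub_apply, dg_apply _ 1 (hb t), dg_apply _ 1 (hb t0), sub_mul]
  simp_rw [heq]
  have := (Real.continuous_sqrt.comp hcont).tendsto t0
  simpa [Function.comp_def] using this

/-- eigenvalues -/
noncomputable def lam (n : ℕ) : ℝ := 2 ^ n

theorem lam_ge (n : ℕ) : (n : ℝ) + 1 ≤ lam n := by
  have := @Nat.lt_two_pow_self n
  unfold lam
  exact_mod_cast this

theorem one_le_lam (n : ℕ) : 1 ≤ lam n := by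
  have := lam_ge n
  have : (0 : ℝ) ≤ n := by positivity
  linarith

theorem lam_pos (n : ℕ) : 0 < lam n := lt_of_lt_of_le one_pos (one_le_lam n)

/-- semigroup multiplier -/
noncomputable def sgm (t : ℝ) (n : ℕ) : ℂ := (Real.exp (-(lam n * max t 0)) : ℝ)

theorem sgm_norm (t : ℝ) (n : ℕ) : ‖sgm t n‖ ≤ Real.exp (-(max t 0)) := by
  rw [sgm, Complex.norm_real, Real.norm_eq_abs, abs_of_pos (Real.exp_pos _)]
  apply Real.exp_le_exp.2
  have := one_le_lam n
  have h2 : 0 ≤ max t 0 := le_max_right _ _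
  nlinarith

theorem sgm_norm' (t : ℝ) (n : ℕ) : ‖sgm t n‖ ≤ 1 :=
  (sgm_norm t n).trans (Real.exp_le_one_iff.2 (by simp))

theorem sgm_cont (n : ℕ) : Continuous fun t => sgm t n := by
  unfold sgm
  fun_prop

theorem T_apply (t : ℝ) (x : XX) (n : ℕ) : dg (sgm t) x n = sgm t n * x n :=
  dg_apply _ 1 (sgm_norm' t) x n

/-- The semigroup. -/
noncomputable def SS : C0Semigroup XX where
  T t := dg (sgm t)
  map_zero := by
    ext x n
    rw [T_apply]
    simp [sgm]
  map_add s t hs ht := by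
    ext x n
    rw [T_apply, ContinuousLinearMap.comp_apply, T_apply, T_apply, ← mul_assoc]
    congr 1
    simp only [sgm]
    rw [← Complex.ofReal_mul, ← Real.exp_add, max_eq_left hs, max_eq_left ht,
      max_eq_left (add_nonneg hs ht)]
    congr 2
    ring
  strongly_continuous x := (dg_cont sgm sgm_norm' sgm_cont x).continuousOn

theorem SS_apply (t : ℝ) (x : XX) (n : ℕ) : SS.T t x n = sgm t n * x n := T_apply t x n

theorem SS_cont (x : XX) : Continuous fun t => SS.T t x := dg_cont sgm sgm_norm' sgm_cont x

theorem SS_norm (t : ℝ) (ht : 0 ≤ t) : ‖SS.T t‖ ≤ 1 * Real.exp (-1 * t) := by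
  have := dg_norm (sgm t) _ (sgm_norm t)
  rw [max_eq_left ht] at this
  simpa [SS] using this

theorem SS_exp : SS.ExpStable := ⟨1, one_pos, 1, SS_norm⟩

theorem SS_growth : -1 ≤ SS.growthBound := by
  unfold C0Semigroup.growthBound
  refine le_csInf ⟨-1, ⟨1, SS_norm⟩⟩ ?_
  rintro w ⟨M, hM⟩
  by_contra! hw
  have key : ∀ t : ℝ, 0 ≤ t → Real.exp ((-1 - w) * t) ≤ M := by
    intro t ht
    have h1 := hM t ht
    have h2 : Real.exp (-t) ≤ ‖SS.T t‖ := by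
      have h3 := (SS.T t).le_opNorm (lp.single 2 0 (1 : ℂ))
      have h4 := lp.norm_apply_le_norm (two_ne_zero) (SS.T t (lp.single 2 0 (1 : ℂ))) 0
      rw [SS_apply] at h4
      rw [lp.norm_single (by norm_num)] at h3
      simp only [lp.single_apply_self, norm_one, mul_one] at h3 h4
      refine le_trans ?_ (h4.trans h3)
      rw [sgm, Complex.norm_real, Real.norm_eq_abs, abs_of_pos (Real.exp_pos _), max_eq_left ht]
      simp [lam]
    have h5 := h2.trans h1
    have h6 : Real.exp ((-1 - w) * t) = Real.exp (-t) * Real.exp (-(w * t)) := by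
      rw [← Real.exp_add]; congr 1; ring
    rw [h6]
    calc _ ≤ M * Real.exp (w * t) * Real.exp (-(w * t)) := by gcongr
      _ = M := by rw [mul_assoc, ← Real.exp_add]; simp
  have h0 := key 0 le_rfl
  have hM0 : 0 ≤ M := (Real.exp_pos _).le.trans h0
  have h1 := key (M / (-1 - w)) (div_nonneg hM0 (by linarith))
  rw [mul_div_cancel₀ _ (by linarith : (-1 - w) ≠ 0)] at h1
  have := Real.add_one_le_exp M
  linarith

/-- the embedding -/
noncomputable def io : XX →L[ℂ] XX := dg fun n => ((lam n)⁻¹ : ℝ)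

theorem io_apply (x : XX) (n : ℕ) : io x n = ((lam n)⁻¹ : ℝ) * x n := by
  apply dg_apply _ 1
  intro n
  rw [Complex.norm_real, Real.norm_eq_abs, abs_of_pos (inv_pos.2 (lam_pos n))]
  exact inv_le_one_of_one_le₀ (one_le_lam n)

theorem io_inj : Function.Injective (fun x : XX => io x) := by
  intro x y h
  refine XX_ext fun n => ?_
  have := congrArg (fun z : XX => z n) h
  simp only [io_apply] at this
  refine mul_left_cancel₀ ?_ this
  exact Complex.ofReal_ne_zero.2 (inv_pos.2 (lam_pos n)).ne'

theorem io_single (n : ℕ) (a : ℂ) : io (lp.single 2 n a) = lp.single 2 n ((((lam n)⁻¹ : ℝ) : ℂ) * a) := by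
  refine XX_ext fun k => ?_
  rw [io_apply, lp.single_apply, lp.single_apply]
  by_cases h : k = n
  · subst h; simp
  · simp [h]

theorem io_dense : DenseRange (fun x : XX => io x) := by
  intro y
  have h := lp.hasSum_single (p := 2) (by norm_num) y
  refine mem_closure_of_tendsto h (Filter.Eventually.of_forall fun s => ?_)
  refine ⟨∑ i ∈ s, lp.single 2 i ((lam i : ℂ) * y i), ?_⟩
  simp only [map_sum]
  refine Finset.sum_congr rfl fun i _ => ?_
  rw [io_single, ← mul_assoc]
  congr 1
  have := (lam_pos i).ne'
  push_cast
  rw [inv_mul_cancel₀ (by exact_mod_cast this), one_mul]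

theorem io_comm (t : ℝ) (x : XX) : SS.T t (io x) = io (SS.T t x) := by
  refine XX_ext fun n => ?_
  rw [SS_apply, io_apply, io_apply, SS_apply]
  ring

theorem XX_eval_integral (f : ℝ → XX) (hf : Continuous f) (a b : ℝ) (n : ℕ) :
    (∫ s in a..b, f s) n = ∫ s in a..b, f s n := by
  have := (lp.evalCLM ℂ (fun _ : ℕ => ℂ) 2 n).intervalIntegral_comp_comm
    (hf.intervalIntegrable a b (μ := volume))
  exact this.symm

theorem gen_int (x : XX) (t : ℝ) (ht : 0 ≤ t) :
    io (SS.T t x) = io x - ∫ s in (0:ℝ)..t, SS.T s x := by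
  refine XX_ext fun n => ?_
  rw [lp.coeFn_sub, Pi.sub_apply, XX_eval_integral _ (SS_cont x), io_apply, io_apply, SS_apply]
  simp_rw [SS_apply]
  rw [intervalIntegral.integral_mul_const]
  have h1 : ∫ s in (0:ℝ)..t, sgm s n = (((lam n)⁻¹ * (1 - Real.exp (-(lam n * t))) : ℝ) : ℂ) := by
    have h2 : ∫ s in (0:ℝ)..t, sgm s n =
        ∫ s in (0:ℝ)..t, ((Real.exp (-(lam n * s)) : ℝ) : ℂ) := by
      apply intervalIntegral.integral_congr
      intro s hs
      rw [Set.uIcc_of_le ht] at hs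
      simp only [sgm, max_eq_left hs.1]
    rw [h2, intervalIntegral.integral_ofReal]
    congr 1
    have hd : ∀ s ∈ Set.uIcc 0 t, HasDerivAt (fun s => -(lam n)⁻¹ * Real.exp (-(lam n * s)))
        (Real.exp (-(lam n * s))) s := by
      intro s _
      have h3 : HasDerivAt (fun s => -(lam n * s)) (-(lam n)) s := by
        simpa using ((hasDerivAt_id s).const_mul (lam n)).fun_neg
      have h4 := h3.exp.const_mul (-(lam n)⁻¹)
      have h5 := (lam_pos n).ne'
      have h6 : -(lam n)⁻¹ * (Real.exp (-(lam n * s)) * -lam n) = Real.exp (-(lam n * s)) := by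
        field_simp
      rwa [h6] at h4
    rw [intervalIntegral.integral_eq_sub_of_hasDerivAt hd
      (Continuous.intervalIntegrable (by fun_prop) _ _)]
    simp
    ring
  rw [h1, sgm, max_eq_left ht]
  push_cast
  ring

theorem gen_deriv (x : XX) (t : ℝ) (ht : 0 ≤ t) :
    HasDerivWithinAt (fun τ : ℝ => io (SS.T τ x)) (-(SS.T t x)) (Set.Ici 0) t := by
  have h := (intervalIntegral.integral_hasDerivAt_right
    ((SS_cont x).intervalIntegrable 0 t) ((SS_cont x).stronglyMeasurableAtFilter _ _)
    (SS_cont x).continuousAt).const_sub (io x)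
  exact h.hasDerivWithinAt.congr (fun s hs => gen_int x s hs) (gen_int x t ht)

theorem unit_aux (s : ℂ) (hs : -1 < s.re) (n : ℕ) :
    0 < min (s.re + 1) 1 ∧ lam n * min (s.re + 1) 1 ≤ ‖s + lam n‖ := by
  have h0 : 0 < min (s.re + 1) 1 := lt_min (by linarith) one_pos
  refine ⟨h0, ?_⟩
  have h1 := Complex.re_le_norm (s + lam n)
  simp only [Complex.add_re, Complex.ofReal_re] at h1
  refine le_trans ?_ h1
  have := one_le_lam n
  rcases le_total (s.re + 1) 1 with h | h
  · rw [min_eq_left h]; nlinarith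
  · rw [min_eq_right h]; linarith

/-- inverse multiplier -/
noncomputable def rsm (s : ℂ) (n : ℕ) : ℂ := lam n / (s + lam n)

theorem rsm_norm (s : ℂ) (hs : -1 < s.re) (n : ℕ) : ‖rsm s n‖ ≤ (min (s.re + 1) 1)⁻¹ := by
  obtain ⟨h0, h1⟩ := unit_aux s hs n
  have hl := lam_pos n
  rw [rsm, norm_div, Complex.norm_real, Real.norm_eq_abs, abs_of_pos hl]
  rw [div_le_iff₀ (lt_of_lt_of_le (by positivity) h1), inv_mul_eq_div, le_div_iff₀ h0]
  exact h1

theorem one_add_isUnit (s : ℂ) (hs : -1 < s.re) : IsUnit (1 + s • io : XX →L[ℂ] XX) := by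
  have key : ∀ (x : XX) n, rsm s n * ((1 + s • io : XX →L[ℂ] XX) x n) = x n := by
    intro x n
    obtain ⟨h0, h1⟩ := unit_aux s hs n
    have hl := lam_pos n
    have hne : s + lam n ≠ 0 := norm_pos_iff.1 (lt_of_lt_of_le (by positivity) h1)
    have hl' : (lam n : ℂ) ≠ 0 := by exact_mod_cast hl.ne'
    have : (1 + s • io : XX →L[ℂ] XX) x n = x n + s * io x n := rfl
    rw [this, io_apply, rsm]
    push_cast
    field_simp
    ring
  have ha := fun x n => dg_apply (rsm s) _ (rsm_norm s hs) x n
  have h1 : dg (rsm s) * (1 + s • io) = 1 := by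
    ext x n
    rw [mul_apply_eq_comp, ha, key]
    rfl
  have h2 : (1 + s • io) * dg (rsm s) = 1 := by
    ext x n
    rw [mul_apply_eq_comp]
    have e : (1 + s • io : XX →L[ℂ] XX) (dg (rsm s) x) n
      = dg (rsm s) ((1 + s • io : XX →L[ℂ] XX) x) n := by
      rw [ha]
      show dg (rsm s) x n + s * io (dg (rsm s) x) n = rsm s n * (x n + s * io x n)
      rw [io_apply, io_apply, ha]
      ring
    rw [e, ha, key]
    rfl
  exact ⟨⟨_, _, h2, h1⟩, rfl⟩

/-- resolvent -/
noncomputable def RR (s : ℂ) : XX →L[ℂ] XX := Ring.inverse (1 + s • io)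

theorem RR_right (s : ℂ) (hs : -1 < s.re) (w : XX) : s • io (RR s w) + RR s w = w := by
  have h := congrArg (fun f : XX →L[ℂ] XX => f w) (Ring.mul_inverse_cancel _ (one_add_isUnit s hs))
  rw [add_comm]
  exact h

theorem RR_left (s : ℂ) (hs : -1 < s.re) (x : XX) : RR s (s • io x + x) = x := by
  have h := congrArg (fun f : XX →L[ℂ] XX => f x) (Ring.inverse_mul_cancel _ (one_add_isUnit s hs))
  rw [add_comm]
  exact h

theorem RR_comm (s : ℂ) (hs : -1 < s.re) (x : XX) : RR s (io x) = io (RR s x) := by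
  conv_lhs => rw [← RR_right s hs x]
  rw [map_add, map_smul, RR_left s hs]

theorem RR_diff (s : ℂ) (hs : -1 < s.re) : DifferentiableAt ℂ RR s := by
  have h1 := differentiableAt_inverse (𝕜 := ℂ) (one_add_isUnit s hs)
  have h2 : DifferentiableAt ℂ (fun s : ℂ => (1 + s • io : XX →L[ℂ] XX)) s := by fun_prop
  exact h1.comp s h2

theorem aa_mem : Memℓp (fun n : ℕ => ((1 / ((n : ℝ) + 1) : ℝ) : ℂ)) 2 := by
  apply memℓp_gen
  have h := (summable_nat_add_iff 1).2 (Real.summable_one_div_nat_pow.2 (one_lt_two))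
  refine h.congr fun n => ?_
  simp only [Complex.norm_real, ENNReal.toReal_ofNat, Real.rpow_ofNat, Real.norm_eq_abs, sq_abs]
  push_cast
  rw [div_pow, one_pow]

/-- The vector `(1/(n+1))`. -/
noncomputable def aa : XX := ⟨_, aa_mem⟩

theorem aa_apply (n : ℕ) : aa n = ((1 / ((n : ℝ) + 1) : ℝ) : ℂ) := rfl

/-- Bounded functional. -/
noncomputable def Cf : XX →L[ℂ] ℂ := innerSL ℂ aa

theorem Cf_hasSum (z : XX) : HasSum (fun n : ℕ => ((1 / ((n : ℝ) + 1) : ℝ) : ℂ) * z n) (Cf z) := by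
  have h := lp.hasSum_inner (𝕜 := ℂ) aa z
  have e : (fun n : ℕ => ((1 / ((n : ℝ) + 1) : ℝ) : ℂ) * z n) = fun n => inner ℂ (aa n) (z n) := by
    funext n
    rw [aa_apply, RCLike.inner_apply, Complex.conj_ofReal, mul_comm]
  rw [e]
  exact h

/-- observation coefficients -/
noncomputable def cc (n : ℕ) : ℝ := 1 / ((n : ℝ) + 1) * lam n

/-- Observation operator. -/
noncomputable def CO (x : XX) : ℂ := ∑' n, (cc n : ℂ) * x n

theorem CO_eq (x z : XX) (h : -x = io z) : CO x = -Cf z := by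
  rw [← map_neg, CO, ← (Cf_hasSum (-z)).tsum_eq]
  refine tsum_congr fun n => ?_
  have h1 := congrArg (fun w : XX => w n) h
  simp only [lp.coeFn_neg, Pi.neg_apply, io_apply] at h1 ⊢
  have hl : (lam n : ℂ) ≠ 0 := by exact_mod_cast (lam_pos n).ne'
  have h2 : x n = - ((((lam n)⁻¹ : ℝ) : ℂ) * z n) := by rw [← h1, neg_neg]
  rw [h2, cc]
  push_cast
  field_simp

/-- The node. -/
noncomputable def ND : SystemNode XX XX XX ℂ where
  S := SS
  Sm1 := SS
  ι := io
  ι_injective := io_inj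
  ι_dense := io_dense
  semigroup_compat t _ x := io_comm t x
  Am1 := -ContinuousLinearMap.id ℂ XX
  generator x t ht := gen_deriv x t ht
  B := io
  Cop := CO
  Cop_add := by
    rintro x y ⟨z, hz⟩ ⟨w, hw⟩
    have hz' : -x = io z := hz
    have hw' : -y = io w := hw
    rw [CO_eq x z hz', CO_eq y w hw', CO_eq (x + y) (z + w) (by rw [map_add, ← hz', ← hw']; abel),
      map_add]
    ring
  Cop_smul := by
    rintro a x ⟨z, hz⟩
    have hz' : -x = io z := hz
    rw [CO_eq x z hz', CO_eq (a • x) (a • z) (by rw [map_smul, ← hz', smul_neg]), map_smul, smul_neg]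
  Cop_bound := by
    refine ⟨‖Cf‖, fun x z hz => ?_⟩
    rw [CO_eq x z hz, norm_neg]
    refine (Cf.le_opNorm z).trans ?_
    gcongr
    linarith [norm_nonneg x]
  R := RR
  R_right s hs w := by
    have := RR_right s (SS_growth.trans_lt hs) w
    show s • io (RR s w) - -RR s w = w
    rwa [sub_neg_eq_add]
  R_left s hs x := by
    have := RR_left s (SS_growth.trans_lt hs) x
    show RR s (s • io x - -x) = x
    rwa [sub_neg_eq_add]
  G s := Cf.comp (RR s)
  G_analytic := by
    intro s hs
    have h := RR_diff s (SS_growth.trans_lt hs)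
    have : DifferentiableAt ℂ (fun s => Cf.comp (RR s)) s :=
      (differentiableAt_const Cf).clm_comp h
    exact this.differentiableWithinAt
  G_shift α β hα hβ u := by
    have ha := RR_comm α (SS_growth.trans_lt hα) u
    have hb := RR_comm β (SS_growth.trans_lt hβ) u
    show Cf (RR α u) - Cf (RR β u) = CO (RR α (io u) - RR β (io u))
    rw [CO_eq _ (-(RR α u - RR β u)) (by rw [ha, hb, map_neg, map_sub])]
    simp

/-- Analytic extension. -/
noncomputable def FF (z : ℂ) : XX →L[ℂ] XX :=
  ∑' n : ℕ, Complex.exp (-(lam n * z)) • dg (Pi.single n 1)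

theorem single_bd (n k : ℕ) : ‖(Pi.single n 1 : ℕ → ℂ) k‖ ≤ 1 := by
  by_cases h : k = n
  · subst h; simp
  · simp [h]

theorem FF_bd (δ : ℝ) (hδ : 0 < δ) (n : ℕ) (z : ℂ) (hz : δ < z.re) :
    ‖Complex.exp (-(lam n * z)) • dg (Pi.single n 1)‖ ≤ Real.exp (-δ) ^ n := by
  rw [norm_smul, Complex.norm_exp]
  have h1 := dg_norm _ 1 (single_bd n)
  have h2 : (-(lam n * z)).re = -(lam n * z.re) := by simp
  rw [h2]
  have h3 : Real.exp (-(lam n * z.re)) ≤ Real.exp (-δ) ^ n := by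
    rw [← Real.exp_nat_mul]
    apply Real.exp_le_exp.2
    have := lam_ge n
    have h4 : (0 : ℝ) ≤ n := by positivity
    nlinarith
  calc _ ≤ Real.exp (-(lam n * z.re)) * 1 := by gcongr
    _ ≤ _ := by rwa [mul_one]

theorem geo_sum (δ : ℝ) (hδ : 0 < δ) : Summable fun n : ℕ => Real.exp (-δ) ^ n :=
  summable_geometric_of_lt_one (Real.exp_pos _).le (Real.exp_lt_one_iff.2 (by linarith))

theorem FF_diff (z : ℂ) (hz : 0 < z.re) : DifferentiableAt ℂ FF z := by
  have hU : IsOpen {w : ℂ | z.re / 2 < w.re} := isOpen_lt continuous_const Complex.continuous_re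
  have h := Complex.differentiableOn_tsum_of_summable_norm (geo_sum (z.re / 2) (by linarith))
    (F := fun (n : ℕ) (z : ℂ) => Complex.exp (-(lam n * z)) • dg (Pi.single n 1))
    (fun n => by
      apply Differentiable.differentiableOn
      fun_prop) hU
    (fun n w hw => FF_bd _ (by linarith) n w hw)
  exact h.differentiableAt (hU.mem_nhds (by simp only [Set.mem_ofPred_eq]; linarith))

theorem FF_apply (z : ℂ) (hz : 0 < z.re) (x : XX) (n : ℕ) :
    FF z x n = Complex.exp (-(lam n * z)) * x n := by
  have hs : Summable fun n : ℕ => Complex.exp (-(lam n * z)) • dg (Pi.single n 1) :=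
    Summable.of_norm_bounded (geo_sum (z.re / 2) (by linarith))
      (fun n => FF_bd _ (by linarith) n z (by linarith))
  have h1 := ((lp.evalCLM ℂ (fun _ : ℕ => ℂ) 2 n).comp
    (ContinuousLinearMap.apply ℂ XX x)).hasSum hs.hasSum
  have h2 : HasSum (fun k : ℕ => Complex.exp (-(lam k * z)) * ((Pi.single k 1 : ℕ → ℂ) n * x n))
      (FF z x n) := by
    have h5 : HasSum (fun k : ℕ => Complex.exp (-(lam k * z)) * dg (Pi.single k 1) x n)
      (FF z x n) := h1
    have h6 : ∀ k, dg (Pi.single k 1) x n = (Pi.single k 1 : ℕ → ℂ) n * x n :=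
      fun k => dg_apply _ 1 (single_bd k) x n
    simp only [h6] at h5
    exact h5
  have h3 := hasSum_single (f := fun k : ℕ => Complex.exp (-(lam k * z)) * ((Pi.single k 1 : ℕ → ℂ) n * x n)) n
    (fun k hk => by simp [hk.symm])
  have h4 := h2.unique h3
  simpa using h4

theorem SS_an : SS.IsAnalytic := by
  have hre : ∀ z : ℂ, (z ≠ 0 ∧ |Complex.arg z| < Real.pi / 4) → 0 < z.re := by
    rintro z ⟨h0, h1⟩
    have h2 : |Complex.arg z| < Real.pi / 2 := by linarith [Real.pi_pos]
    exact (Complex.abs_arg_lt_pi_div_two_iff.1 h2).resolve_right h0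
  refine ⟨Real.pi / 4, ⟨by linarith [Real.pi_pos], by linarith [Real.pi_pos]⟩, FF, ?_, ?_, ?_⟩
  · intro z hz
    exact (FF_diff z (hre z hz)).differentiableWithinAt
  · intro t ht
    ext x n
    rw [FF_apply _ (by simpa using ht), SS_apply, sgm, max_eq_left ht.le]
    push_cast
    rfl
  · intro z w hz hw
    have h1 := hre z hz
    have h2 := hre w hw
    ext x n
    rw [FF_apply _ (by simp only [Complex.add_re]; linarith), ContinuousLinearMap.comp_apply,
      FF_apply z h1, FF_apply w h2, ← mul_assoc, ← Complex.exp_add]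
    congr 2
    ring

theorem abs_mem (x : XX) : Memℓp (fun n : ℕ => (‖x n‖ : ℂ)) 2 := by
  apply memℓp_gen
  refine (XX_sq x).summable.congr fun n => ?_
  simp

theorem abs_sum (x : XX) : ∃ S : ℝ, HasSum (fun n : ℕ => 1 / ((n : ℝ) + 1) * ‖x n‖) S ∧
    S ≤ ‖Cf‖ * ‖x‖ := by
  let y : XX := ⟨_, abs_mem x⟩
  have hy : ‖y‖ ≤ 1 * ‖x‖ := by
    refine XX_norm_le _ _ _ zero_le_one fun n => ?_
    show ‖(‖x n‖ : ℂ)‖ ≤ _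
    simp
  have h := Cf_hasSum y
  have h2 := Complex.hasSum_re h
  refine ⟨(Cf y).re, ?_, ?_⟩
  · convert h2 using 2 with n
    show _ = (((1 / ((n : ℝ) + 1) : ℝ) : ℂ) * (‖x n‖ : ℂ)).re
    rw [← Complex.ofReal_mul, Complex.ofReal_re]
  · refine (Complex.re_le_norm _).trans ((Cf.le_opNorm y).trans ?_)
    gcongr
    linarith

theorem lint_exp (l : ℝ) (hl : 0 < l) :
    ∫⁻ s in Set.Ioc (0:ℝ) 1, ENNReal.ofReal (l * Real.exp (-(l * s))) ≤ 1 := by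
  have hi : IntervalIntegrable (fun s => l * Real.exp (-(l * s))) volume 0 1 :=
    Continuous.intervalIntegrable (by fun_prop) _ _
  rw [← ofReal_integral_eq_lintegral_ofReal
    ((intervalIntegrable_iff_integrableOn_Ioc_of_le zero_le_one).1 hi)
    (Filter.Eventually.of_forall fun s => by positivity),
    ← intervalIntegral.integral_of_le zero_le_one]
  have hd : ∀ s ∈ Set.uIcc (0:ℝ) 1, HasDerivAt (fun s => -Real.exp (-(l * s)))
      (l * Real.exp (-(l * s))) s := by
    intro s _
    have h3 : HasDerivAt (fun s => -(l * s)) (-l) s := by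
      simpa using ((hasDerivAt_id s).const_mul l).fun_neg
    have h4 := h3.exp.fun_neg
    have h6 : -(Real.exp (-(l * s)) * -l) = l * Real.exp (-(l * s)) := by ring
    rwa [h6] at h4
  rw [intervalIntegral.integral_eq_sub_of_hasDerivAt hd hi]
  rw [ENNReal.ofReal_le_one]
  have := Real.exp_pos (-(l * 1))
  simp at this ⊢
  linarith

theorem ND_obs : ND.ObservationAdmissible 1 := by
  refine ⟨1, one_pos, ‖Cf‖, fun x z _ => ?_⟩
  obtain ⟨S, hS, hle⟩ := abs_sum x
  have hS0 : 0 ≤ S := hS.nonneg fun n => by positivity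
  refine ENNReal.toReal_le_of_le_ofReal (by positivity) (le_trans ?_ (ENNReal.ofReal_le_ofReal hle))
  rw [eLpNorm_one_eq_lintegral_enorm]
  have hpt : ∀ s ∈ Set.Ioc (0:ℝ) 1, ‖ND.Cop (ND.S.T s x)‖ₑ ≤
      ∑' n : ℕ, ENNReal.ofReal (1 / ((n : ℝ) + 1) * ‖x n‖) *
        ENNReal.ofReal (lam n * Real.exp (-(lam n * s))) := by
    intro s hs
    show ‖CO (SS.T s x)‖ₑ ≤ _
    rw [CO]
    refine enorm_tsum_le_tsum_enorm.trans (le_of_eq (tsum_congr fun n => ?_))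
    have hl := lam_pos n
    rw [← ENNReal.ofReal_mul (by positivity), ← ofReal_norm, SS_apply, sgm,
      max_eq_left hs.1.le, norm_mul, norm_mul, Complex.norm_real, Complex.norm_real,
      Real.norm_eq_abs, Real.norm_eq_abs, abs_of_pos (Real.exp_pos _), cc,
      abs_of_pos (by positivity)]
    congr 1
    ring
  calc _ ≤ ∫⁻ s in Set.Ioc (0:ℝ) 1, ∑' n : ℕ, ENNReal.ofReal (1 / ((n : ℝ) + 1) * ‖x n‖) *
        ENNReal.ofReal (lam n * Real.exp (-(lam n * s))) :=
        setLIntegral_mono' measurableSet_Ioc hpt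
    _ = ∑' n : ℕ, ∫⁻ s in Set.Ioc (0:ℝ) 1, ENNReal.ofReal (1 / ((n : ℝ) + 1) * ‖x n‖) *
        ENNReal.ofReal (lam n * Real.exp (-(lam n * s))) := by
        apply lintegral_tsum
        intro n
        apply Measurable.aemeasurable
        fun_prop
    _ ≤ ∑' n : ℕ, ENNReal.ofReal (1 / ((n : ℝ) + 1) * ‖x n‖) := by
        refine ENNReal.tsum_le_tsum fun n => ?_
        rw [lintegral_const_mul _ (by fun_prop)]
        calc _ ≤ ENNReal.ofReal (1 / ((n : ℝ) + 1) * ‖x n‖) * 1 := by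
              gcongr
              exact lint_exp _ (lam_pos n)
          _ = _ := mul_one _
    _ = ENNReal.ofReal S := by
        rw [← hS.tsum_eq, ENNReal.ofReal_tsum_of_nonneg (fun n => by positivity) hS.summable]

/-- finitely supported vectors -/
noncomputable def vec (N : ℕ) (f : ℕ → ℝ) : XX := ∑ k ∈ Finset.range N, lp.single 2 k (f k : ℂ)

theorem vec_apply (N : ℕ) (f : ℕ → ℝ) (n : ℕ) : vec N f n = if n < N then (f n : ℂ) else 0 := by
  rw [vec, lp.coeFn_sum, Finset.sum_apply]
  have : ∀ k ∈ Finset.range N, (lp.single 2 k (f k : ℂ) : XX) n = if k = n then (f n : ℂ) else 0 := by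
    intro k _
    rw [lp.single_apply]
    by_cases h : n = k
    · subst h; simp
    · simp [h, Ne.symm h]
  rw [Finset.sum_congr rfl this, Finset.sum_ite_eq' (Finset.range N) n (fun _ => (f n : ℂ))]
  simp

theorem vec_norm (N : ℕ) (f : ℕ → ℝ) : ‖vec N f‖ ≤ ∑ k ∈ Finset.range N, |f k| := by
  refine (norm_sum_le _ _).trans (Finset.sum_le_sum fun k _ => ?_)
  rw [lp.norm_single (by norm_num), Complex.norm_real, Real.norm_eq_abs]

theorem vec_cont (N : ℕ) (f : ℝ → ℕ → ℝ) (hf : ∀ k, Continuous fun t => f t k) :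
    Continuous fun t => vec N (f t) := by
  unfold vec
  refine continuous_finsetSum _ fun k _ => ?_
  have h := (lp.singleContinuousLinearMap ℂ (fun _ : ℕ => ℂ) 2 k).continuous
  have h2 : Continuous fun t => (f t k : ℂ) := Complex.continuous_ofReal.comp (hf k)
  exact h.comp h2

theorem vec_io (N : ℕ) (f : ℕ → ℝ) : io (vec N f) = vec N (fun k => (lam k)⁻¹ * f k) := by
  refine XX_ext fun n => ?_
  rw [io_apply, vec_apply, vec_apply]
  split_ifs <;> simp

theorem vec_T (N : ℕ) (f : ℕ → ℝ) (t : ℝ) :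
    SS.T t (vec N f) = vec N (fun k => Real.exp (-(lam k * max t 0)) * f k) := by
  refine XX_ext fun n => ?_
  rw [SS_apply, vec_apply, vec_apply, sgm]
  split_ifs
  · rw [Complex.ofReal_mul]
  · simp

theorem vec_smul (N : ℕ) (f : ℕ → ℝ) (c : ℝ) :
    c • vec N f = vec N (fun k => c * f k) := by
  refine XX_ext fun n => ?_
  have : (c • vec N f) n = (c : ℂ) * vec N f n := rfl
  rw [this, vec_apply, vec_apply]
  split_ifs <;> simp

theorem vec_int (N : ℕ) (f : ℝ → ℕ → ℝ) (hf : ∀ k, Continuous fun t => f t k) (a b : ℝ) :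
    ∫ s in a..b, vec N (f s) = vec N (fun k => ∫ s in a..b, f s k) := by
  refine XX_ext fun n => ?_
  rw [XX_eval_integral _ (vec_cont N f hf), vec_apply]
  simp_rw [vec_apply]
  split_ifs
  · rw [intervalIntegral.integral_ofReal]
  · simp

theorem vec_CO (N : ℕ) (f : ℕ → ℝ) :
    CO (vec N f) = ((∑ k ∈ Finset.range N, cc k * f k : ℝ) : ℂ) := by
  rw [CO, tsum_eq_sum (s := Finset.range N)]
  · push_cast
    refine Finset.sum_congr rfl fun k hk => ?_
    rw [vec_apply, if_pos (Finset.mem_range.1 hk)]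
  · intro k hk
    rw [vec_apply, if_neg (by simpa using hk), mul_zero]

theorem ND_CD (x v z : XX) (h : -x = io z) : ND.CD x v = CO x := by
  have hb : ND.S.growthBound < ND.betaPt.re := by
    simp [SystemNode.betaPt]
  have hc := RR_comm ND.betaPt (SS_growth.trans_lt hb) v
  show CO (x - RR ND.betaPt (io v)) + Cf (RR ND.betaPt v) = CO x
  rw [CO_eq x z h, CO_eq (x - RR ND.betaPt (io v)) (z + RR ND.betaPt v)
    (by rw [map_add, ← h, ← hc]; abel), map_add]
  ring

/-- input components -/
noncomputable def uk (s : ℝ) (k : ℕ) : ℝ :=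
  Real.exp (-(lam k / 2 * (1 - s))) - Real.exp (-(lam k * (1 - s)))

/-- particular solution -/
noncomputable def wk (s : ℝ) (k : ℕ) : ℝ :=
  Real.exp (-(lam k / 2 * (1 - s))) * (2 / (3 * lam k)) -
    Real.exp (-(lam k * (1 - s))) * (1 / (2 * lam k))

/-- state components -/
noncomputable def xk (t : ℝ) (k : ℕ) : ℝ := wk t k - Real.exp (-(lam k * t)) * wk 0 k

theorem uk_cont (k : ℕ) : Continuous fun s => uk s k := by unfold uk; fun_prop

theorem xk_cont (k : ℕ) : Continuous fun s => xk s k := by unfold xk wk; fun_prop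

theorem uk_norm (N : ℕ) (s : ℝ) (hs : s ≤ 1) : ‖vec N (uk s)‖ ≤ 1 := by
  refine (vec_norm _ _).trans ?_
  have h1 : ∀ k ∈ Finset.range N, |uk s k| =
      Real.exp (-(lam k / 2 * (1 - s))) - Real.exp (-(lam (k + 1) / 2 * (1 - s))) := by
    intro k _
    have h2 : lam (k + 1) / 2 = lam k := by unfold lam; rw [pow_succ]; ring
    rw [h2, abs_of_nonneg]
    · rfl
    · rw [uk, sub_nonneg]
      apply Real.exp_le_exp.2
      have := lam_pos k
      nlinarith
  rw [Finset.sum_congr rfl h1, Finset.sum_range_sub']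
  have h3 : Real.exp (-(lam 0 / 2 * (1 - s))) ≤ 1 := by
    apply Real.exp_le_one_iff.2
    have := lam_pos 0
    nlinarith
  have := Real.exp_pos (-(lam N / 2 * (1 - s)))
  linarith

theorem xk_int (t : ℝ) (ht : 0 ≤ t) (k : ℕ) :
    ∫ s in (0:ℝ)..t, Real.exp (-(lam k * max (t - s) 0)) * ((lam k)⁻¹ * uk s k)
      = (lam k)⁻¹ * xk t k := by
  have h2 : ∫ s in (0:ℝ)..t, Real.exp (-(lam k * max (t - s) 0)) * ((lam k)⁻¹ * uk s k) =
      ∫ s in (0:ℝ)..t, (lam k)⁻¹ * (Real.exp (-(lam k * (t - s))) * uk s k) := by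
    apply intervalIntegral.integral_congr
    intro s hs
    rw [Set.uIcc_of_le ht] at hs
    simp only [max_eq_left (sub_nonneg.2 hs.2)]
    ring
  rw [h2, intervalIntegral.integral_const_mul]
  congr 1
  have hl := (lam_pos k).ne'
  have hd : ∀ s ∈ Set.uIcc 0 t, HasDerivAt (fun s => Real.exp (-(lam k * (t - s))) * wk s k)
      (Real.exp (-(lam k * (t - s))) * uk s k) s := by
    intro s _
    have a1 : ∀ l c : ℝ, HasDerivAt (fun s => Real.exp (-(l * (c - s))))
        (Real.exp (-(l * (c - s))) * l) s := by
      intro l c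
      have h3 : HasDerivAt (fun s => -(l * (c - s))) l s := by
        simpa using (((hasDerivAt_id s).const_sub c).const_mul l).fun_neg
      exact h3.exp
    have a2 := (a1 (lam k) t).fun_mul (((a1 (lam k / 2) 1).mul_const (2 / (3 * lam k))).fun_sub
      ((a1 (lam k) 1).mul_const (1 / (2 * lam k))))
    refine a2.congr_deriv ?_
    unfold uk
    field_simp
    ring
  rw [intervalIntegral.integral_eq_sub_of_hasDerivAt hd]
  · simp [xk]
  · have := uk_cont k
    exact Continuous.intervalIntegrable (by fun_prop) _ _

theorem xk_one (k : ℕ) : 1 / 100 ≤ lam k * xk 1 k := by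
  have hl := (lam_pos k)
  have e1 : Real.exp (-(lam k)) * Real.exp (-(lam k / 2)) ≤ 10 / 44 := by
    rw [← Real.exp_add]
    have h1 : Real.exp (-lam k + -(lam k / 2)) ≤ Real.exp (-(3 / 2)) :=
      Real.exp_le_exp.2 (by linarith [one_le_lam k])
    refine h1.trans ?_
    have h2 : Real.exp (-(3 / 2)) ^ 2 * Real.exp 1 ^ 3 = 1 := by
      rw [← Real.exp_nat_mul, ← Real.exp_nat_mul, ← Real.exp_add]
      norm_num
    have h3 := Real.exp_one_gt_d9
    have h4 : (2.7 : ℝ) ^ 3 ≤ Real.exp 1 ^ 3 := by gcongr; linarith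
    by_contra! hc
    have h5 : (10 / 44 : ℝ) ^ 2 ≤ Real.exp (-(3 / 2)) ^ 2 := by gcongr
    have h6 : (10 / 44 : ℝ) ^ 2 * 2.7 ^ 3 ≤ 1 := by
      rw [← h2]; gcongr
    norm_num at h6
  have e2 := mul_pos (Real.exp_pos (-(lam k))) (Real.exp_pos (-(lam k)))
  have e3 : lam k * xk 1 k = 2 / 3 - 1 / 2 - 2 / 3 * (Real.exp (-(lam k)) * Real.exp (-(lam k / 2)))
      + 1 / 2 * (Real.exp (-(lam k)) * Real.exp (-(lam k))) := by
    unfold xk wk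
    simp only [sub_self, mul_zero, neg_zero, Real.exp_zero, mul_one, sub_zero]
    field_simp
    ring
  rw [e3]
  linarith

theorem dd (f : ℝ → ℝ) (hf : Continuous f) (t : ℝ) :
    HasDerivAt (fun t => ∫ s in (0:ℝ)..t, (t - s) * f s) (∫ s in (0:ℝ)..t, f s) t := by
  have h1 := hf.integral_hasStrictDerivAt 0 t |>.hasDerivAt
  have hg : Continuous fun s => s * f s := by fun_prop
  have h2 := hg.integral_hasStrictDerivAt 0 t |>.hasDerivAt
  have h3 := ((hasDerivAt_id t).fun_mul h1).fun_sub h2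
  have e : (fun t => ∫ s in (0:ℝ)..t, (t - s) * f s) =
      fun t => id t * (∫ s in (0:ℝ)..t, f s) - ∫ s in (0:ℝ)..t, s * f s := by
    funext t
    rw [id, ← intervalIntegral.integral_const_mul, ← intervalIntegral.integral_sub]
    · congr 1; funext s; ring
    · exact Continuous.intervalIntegrable (by fun_prop) _ _
    · exact Continuous.intervalIntegrable (by fun_prop) _ _
  rw [e]
  refine h3.congr_deriv ?_
  simp

theorem dist_id (H H1 g : ℝ → ℝ) (h1 : ∀ t, HasDerivAt H (H1 t) t) (h2 : ∀ t, HasDerivAt H1 (g t) t)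
    (hg : Continuous g) (φ : ℝ → ℝ) (hφ : ContDiff ℝ (⊤ : ℕ∞) φ) (hc : HasCompactSupport φ) :
    ∫ t, deriv (deriv φ) t * H t = ∫ t, φ t * g t := by
  have cH : Continuous H := continuous_iff_continuousAt.2 fun t => (h1 t).continuousAt
  have cH1 : Continuous H1 := continuous_iff_continuousAt.2 fun t => (h2 t).continuousAt
  have hφ1 : ContDiff ℝ (⊤ : ℕ∞) (deriv φ) := by
    have := (contDiff_infty_iff_deriv (𝕜 := ℝ)).1 hφ
    exact this.2
  have hφ2 : ContDiff ℝ (⊤ : ℕ∞) (deriv (deriv φ)) := (contDiff_infty_iff_deriv.1 hφ1).2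
  have hc1 := hc.deriv
  have hc2 := hc1.deriv
  have i : ∀ p q : ℝ → ℝ, Continuous p → Continuous q → HasCompactSupport p → Integrable (p * q) :=
    fun p q hp hq hpc => (hp.mul hq).integrable_of_hasCompactSupport hpc.mul_right
  have d0 : ∀ t, HasDerivAt φ (deriv φ t) t := fun t =>
    (contDiff_infty_iff_deriv.1 hφ).1.differentiableAt.hasDerivAt
  have d1 : ∀ t, HasDerivAt (deriv φ) (deriv (deriv φ) t) t := fun t =>
    (contDiff_infty_iff_deriv.1 hφ1).1.differentiableAt.hasDerivAt
  have s1 := integral_mul_deriv_eq_deriv_mul_of_integrable (u := deriv φ) (v := H)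
    (fun t _ => d1 t) (fun t _ => h1 t)
    (i _ _ hφ1.continuous cH1 hc1) (i _ _ hφ2.continuous cH hc2) (i _ _ hφ1.continuous cH hc1)
  have s2 := integral_mul_deriv_eq_deriv_mul_of_integrable (u := φ) (v := H1)
    (fun t _ => d0 t) (fun t _ => h2 t)
    (i _ _ hφ.continuous hg hc) (i _ _ hφ1.continuous cH1 hc1) (i _ _ hφ.continuous cH1 hc)
  linarith

theorem ae_of_dist (H H1 g : ℝ → ℝ) (h1 : ∀ t, HasDerivAt H (H1 t) t)
    (h2 : ∀ t, HasDerivAt H1 (g t) t) (hg : Continuous g) (y : ℝ → ℂ)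
    (hy : LocallyIntegrableOn y (Set.Ici 0))
    (h : ∀ φ : ℝ → ℝ, ContDiff ℝ (⊤ : ℕ∞) φ → HasCompactSupport φ → tsupport φ ⊆ Set.Ioi 0 →
      ∫ t in Set.Ioi (0:ℝ), deriv (deriv φ) t • (H t : ℂ) = ∫ t in Set.Ioi (0:ℝ), φ t • y t) :
    ∀ᵐ t, t ∈ Set.Ioi (0:ℝ) → y t = g t := by
  have hgc : Continuous fun t => (g t : ℂ) := by fun_prop
  have hyU : LocallyIntegrableOn y (Set.Ioi 0) := hy.mono_set Set.Ioi_subset_Ici_self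
  have hgU : LocallyIntegrableOn (fun t => (g t : ℂ)) (Set.Ioi 0) :=
    hgc.locallyIntegrable.locallyIntegrableOn _
  have key := (isOpen_Ioi (a := (0:ℝ))).ae_eq_zero_of_integral_contDiff_smul_eq_zero
    (f := fun t => y t - g t) (μ := volume) (hyU.sub hgU) ?_
  · filter_upwards [key] with t ht h0
    exact sub_eq_zero.1 (ht h0)
  intro φ hφ hc hs
  have z0 : ∀ t, t ∉ Set.Ioi (0:ℝ) → φ t = 0 := fun t ht =>
    image_eq_zero_of_notMem_tsupport fun h => ht (hs h)
  have z2 : ∀ t, t ∉ Set.Ioi (0:ℝ) → deriv (deriv φ) t = 0 := fun t ht =>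
    image_eq_zero_of_notMem_tsupport fun h =>
      ht (hs (tsupport_deriv_subset (tsupport_deriv_subset h)))
  have e := h φ hφ hc hs
  rw [setIntegral_eq_integral_of_forall_compl_eq_zero (fun t ht => by rw [z2 t ht, zero_smul]),
    setIntegral_eq_integral_of_forall_compl_eq_zero (fun t ht => by rw [z0 t ht, zero_smul])] at e
  have e2 := dist_id H H1 g h1 h2 hg φ hφ hc
  have e3 : ∫ t, deriv (deriv φ) t • (H t : ℂ) = ∫ t, φ t • (g t : ℂ) := by
    have := congrArg (fun r : ℝ => (r : ℂ)) e2
    simp only [← integral_complex_ofReal] at this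
    simpa using this
  have int : ∀ f : ℝ → ℂ, LocallyIntegrableOn f (Set.Ioi 0) → Integrable (fun t => φ t • f t) := by
    intro f hf
    have a1 := hf.integrableOn_compact_subset hs hc
    have a2 := a1.continuousOn_smul (hφ.continuous.continuousOn) hc
    refine (integrableOn_iff_integrable_of_support_subset ?_).1 a2
    exact (Function.support_smul_subset_left φ f).trans (subset_tsupport φ)
  simp_rw [smul_sub]
  rw [integral_sub (int y hyU) (int _ hgU), ← e, e3, sub_self]

theorem ND_not : ¬ ND.LInfBIBOStable := by
  rintro ⟨c, hc, H⟩
  have hdiv := Real.tendsto_sum_range_one_div_nat_succ_atTop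
  obtain ⟨N, hN⟩ := (hdiv.eventually_gt_atTop (100 * c)).exists
  have ucont : Continuous fun s => vec N (uk s) := vec_cont N uk uk_cont
  have xcont : ∀ k, Continuous fun t => (lam k)⁻¹ * xk t k := fun k => (xk_cont k).const_mul _
  have mild : ND.IsMildState 0 (fun s => vec N (uk s))
      (fun t => vec N (fun k => (lam k)⁻¹ * xk t k)) := by
    refine ⟨ucont.locallyIntegrable.locallyIntegrableOn _, (vec_cont N _ xcont).continuousOn, ?_⟩
    intro t ht
    have e1 : ∀ s, ND.Sm1.T (t - s) (ND.B (vec N (uk s))) =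
        vec N (fun k => Real.exp (-(lam k * max (t - s) 0)) * ((lam k)⁻¹ * uk s k)) := by
      intro s
      show SS.T (t - s) (io (vec N (uk s))) = _
      rw [vec_io, vec_T]
    have c1 : ∀ k, Continuous fun s =>
        Real.exp (-(lam k * max (t - s) 0)) * ((lam k)⁻¹ * uk s k) := by
      intro k
      have := uk_cont k
      fun_prop
    simp only [e1]
    refine ⟨(vec_cont N _ c1).intervalIntegrable _ _, ?_⟩
    rw [map_zero, map_zero, zero_add]
    refine Eq.trans ?_ (vec_int N _ c1 0 t).symm
    congr 1
    funext k
    exact (xk_int t ht k).symm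
  obtain ⟨y, ⟨hyl, K, L, hK, -, -, hφ⟩, hb⟩ := H _ _ mild (by
    intro t ht
    obtain ⟨M, hM⟩ := (isCompact_Icc (a := (0:ℝ)) (b := t)).exists_bound_of_continuousOn
      ucont.continuousOn
    refine ⟨M, ?_⟩
    filter_upwards [ae_restrict_mem measurableSet_Ioc] with s hs
    exact hM s ⟨hs.1.le, hs.2⟩)
  have hK' : ∀ t, 0 ≤ t → K t = vec N (fun k => ∫ s in (0:ℝ)..t, (t - s) * xk s k) := by
    intro t ht
    apply io_inj
    show io (K t) = io _
    refine (hK t ht).trans ?_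
    have c1 : ∀ k, Continuous fun s => (t - s) * ((lam k)⁻¹ * xk s k) := by
      intro k
      have := xk_cont k
      fun_prop
    have := vec_int N (fun s k => (t - s) * ((lam k)⁻¹ * xk s k)) c1 0 t
    simp only [← vec_smul] at this
    refine this.trans ?_
    rw [vec_io]
    congr 1
    funext k
    rw [← intervalIntegral.integral_const_mul]
    congr 1
    funext s
    ring
  have hCD : ∀ t, 0 ≤ t → ND.CD (K t) (L t) =
      ((∑ k ∈ Finset.range N, cc k * ∫ s in (0:ℝ)..t, (t - s) * xk s k : ℝ) : ℂ) := by
    intro t ht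
    rw [ND_CD (K t) (L t) (vec N (fun k => - (lam k * ∫ s in (0:ℝ)..t, (t - s) * xk s k))),
      hK' t ht, vec_CO]
    rw [hK' t ht, vec_io]
    refine XX_ext fun n => ?_
    rw [lp.coeFn_neg, Pi.neg_apply, vec_apply, vec_apply]
    have := (lam_pos n).ne'
    split_ifs
    · rw [mul_neg, inv_mul_cancel_left₀ this, Complex.ofReal_neg]
    · simp
  set g : ℝ → ℝ := fun t => ∑ k ∈ Finset.range N, cc k * xk t k with hg
  have gc : Continuous g := continuous_finsetSum _ fun k _ => (xk_cont k).const_mul _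
  have hae := ae_of_dist (fun t => ∑ k ∈ Finset.range N, cc k * ∫ s in (0:ℝ)..t, (t - s) * xk s k)
    (fun t => ∑ k ∈ Finset.range N, cc k * ∫ s in (0:ℝ)..t, xk s k) g
    (fun t => HasDerivAt.fun_sum fun k _ => (dd _ (xk_cont k) t).const_mul _)
    (fun t => HasDerivAt.fun_sum fun k _ =>
      ((xk_cont k).integral_hasStrictDerivAt 0 t).hasDerivAt.const_mul _) gc y hyl
    (by
      intro φ h1 h2 h3
      rw [← hφ φ h1 h2 h3]
      refine setIntegral_congr_fun measurableSet_Ioi fun t ht => ?_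
      rw [hCD t (le_of_lt ht)])
  have hb1 := hb 1 one_pos 1 (by
    filter_upwards [ae_restrict_mem measurableSet_Ioc] with s hs
    exact uk_norm N s hs.2)
  rw [ae_restrict_iff' measurableSet_Ioc] at hb1
  have g1 : c < g 1 := by
    have : ∑ k ∈ Finset.range N, (1 / ((k : ℝ) + 1)) * (1 / 100) ≤ g 1 := by
      refine Finset.sum_le_sum fun k _ => ?_
      rw [cc, mul_assoc]
      gcongr
      exact xk_one k
    rw [← Finset.sum_mul] at this
    linarith
  have ho : IsOpen ({t | c < g t} ∩ Set.Ioo 0 1) := (isOpen_lt continuous_const gc).inter isOpen_Ioo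
  have hz : volume ({t | c < g t} ∩ Set.Ioo (0:ℝ) 1) = 0 := by
    rw [measure_eq_zero_iff_ae_notMem]
    filter_upwards [hae, hb1] with t h1 h2 h3
    have h4 := h2 ⟨h3.2.1, h3.2.2.le⟩
    rw [h1 h3.2.1, Complex.norm_real, mul_one] at h4
    exact absurd (h4.trans_lt h3.1) (not_lt.2 (le_abs_self _))
  have hemp := (ho.measure_eq_zero_iff volume).1 hz
  have hev : ∀ᶠ t in 𝓝[<] (1:ℝ), t ∈ {t | c < g t} ∩ Set.Ioo (0:ℝ) 1 := by
    have a1 : ∀ᶠ t in 𝓝[<] (1:ℝ), c < g t :=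
      nhdsWithin_le_nhds ((isOpen_lt continuous_const gc).mem_nhds g1)
    have a2 : ∀ᶠ t in 𝓝[<] (1:ℝ), t ∈ Set.Ioo (0:ℝ) 1 := Ioo_mem_nhdsLT one_pos
    filter_upwards [a1, a2] with t h1 h2 using ⟨h1, h2⟩
  obtain ⟨t, ht⟩ := hev.exists
  rw [hemp] at ht
  exact ht

end witness

/-- Proposition 6.5: there exist a Hilbert space, a generator of an
exponentially stable analytic semigroup and an `L¹`-admissible observation operator
such that the corresponding system node with identity input operator is not
`L^∞`-BIBO stable. -/
theorem exists_L1admissible_not_lInfBIBO :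
    Nonempty L1AdmissibleNotBIBOWitness := by
  refine ⟨{ W := ⟨XX⟩, Wm1 := ⟨XX⟩, node := ND, expStable := SS_exp, analytic := SS_an,
            input_identity := fun x => rfl, transfer_eq := ?_, obsAdmissible := ND_obs,
            not_bibo := ND_not }⟩
  intro s hs x
  show Cf (RR s x) = CO (RR s (io x))
  rw [CO_eq _ (-(RR s x)) (by rw [RR_comm s (SS_growth.trans_lt hs), map_neg]), map_neg, neg_neg]
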